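/- Let n be a positive integer. The ratio of Abelian integrals F_n(h) = A_n(h)/A_0(h) is strictly decreasing as a function of h on the interval (p₁, 0). -/

import Mathlib

open MeasureTheory Set

/-- Change of variables along a monotone branch of `Φ` with inverse `γ`. -/
lemma integrableOn_and_setIntegral_comp_branch {Φ φ γ : ℝ → ℝ} {S T : Set ℝ}
    (hS : MeasurableSet S) (hd : ∀ u ∈ S, HasDerivAt Φ (φ u) u) (hφ : ∀ u ∈ S, φ u ≠ 0)
    (himg : Φ '' S = T) (hγ : ∀ u ∈ S, γ (Φ u) = u) {f K : ℝ → ℝ}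
    (hint : IntegrableOn (fun u => f u * K (Φ u)) S) :
    IntegrableOn (fun s => f (γ s) / |φ (γ s)| * K s) T ∧
      ∫ u in S, f u * K (Φ u) = ∫ s in T, f (γ s) / |φ (γ s)| * K s := by
  have hinj : InjOn Φ S := fun x hx y hy hxy => by rw [← hγ x hx, ← hγ y hy, hxy]
  have hd' : ∀ u ∈ S, HasDerivWithinAt Φ (φ u) S u := fun u hu => (hd u hu).hasDerivWithinAt
  have key : ∀ u ∈ S,
      |φ u| • (f (γ (Φ u)) / |φ (γ (Φ u))| * K (Φ u)) = f u * K (Φ u) := by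
    intro u hu
    have : |φ u| ≠ 0 := abs_ne_zero.mpr (hφ u hu)
    rw [hγ u hu, smul_eq_mul]
    field_simp
  subst himg
  refine ⟨?_, ?_⟩
  · rw [integrableOn_image_iff_integrableOn_abs_deriv_smul hS hd' hinj]
    exact hint.congr_fun (fun u hu => (key u hu).symm) hS
  · rw [integral_image_eq_integral_abs_deriv_smul hS hd' hinj]
    exact setIntegral_congr_fun hS (fun u hu => (key u hu).symm)

lemma setIntegral_Ioo_neg {p b c t : ℝ} (hpb : p < b) (hbc : b ≤ c) {f : ℝ → ℝ}
    (hf : IntegrableOn f (Ioo p c)) (hle : ∀ s ∈ Ioo p c, f s ≤ 0)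
    (hlt : ∀ s ∈ Ioo p b, s ≠ t → f s < 0) : ∫ s in Ioo p c, f s < 0 := by
  have h : 0 < ∫ s in Ioo p c, -f s := by
    rw [setIntegral_pos_iff_support_of_nonneg_ae (f := fun s => -f s) _ hf.neg]
    · have hsub : Ioo p b \ {t} ⊆ Function.support (fun s => -f s) ∩ Ioo p c := by
        rintro s ⟨hs, hst⟩
        exact ⟨by simpa using (hlt s hs hst).ne, hs.1, hs.2.trans_le hbc⟩
      refine lt_of_lt_of_le ?_ (measure_mono hsub)
      rw [measure_sdiff_null (by simp)]
      simpa using hpb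
    · filter_upwards [ae_restrict_mem measurableSet_Ioo] with s hs
      simpa using hle s hs
  rw [integral_neg] at h
  linarith

/-- A Chebyshev-type inequality: if `v / w` is decreasing and `K₂ / K₁` is increasing, then
the `w K₂`-average of `v / w` is smaller than its `w K₁`-average. -/
lemma integral_mul_integral_lt_of_cross_mul {p b c : ℝ} (hpb : p < b) (hbc : b ≤ c)
    {v w K₁ K₂ : ℝ → ℝ}
    (hw₁ : IntegrableOn (fun s => w s * K₁ s) (Ioo p c))
    (hw₂ : IntegrableOn (fun s => w s * K₂ s) (Ioo p c))
    (hv₁ : IntegrableOn (fun s => v s * K₁ s) (Ioo p c))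
    (hv₂ : IntegrableOn (fun s => v s * K₂ s) (Ioo p c))
    (hvw : ∀ s t, p < s → s < t → t < c → w s * v t < v s * w t)
    (hK : ∀ s t, p < s → s < t → t < c → K₂ s * K₁ t ≤ K₁ s * K₂ t)
    (hK' : ∀ s t, p < s → s < t → t < c → s < b → K₂ s * K₁ t < K₁ s * K₂ t) :
    (∫ s in Ioo p c, v s * K₂ s) * (∫ s in Ioo p c, w s * K₁ s) <
      (∫ s in Ioo p c, v s * K₁ s) * (∫ s in Ioo p c, w s * K₂ s) := by
  set D₁ := ∫ s in Ioo p c, w s * K₁ s with hD₁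
  set D₂ := ∫ s in Ioo p c, w s * K₂ s with hD₂
  set N₁ := ∫ s in Ioo p c, v s * K₁ s with hN₁
  set N₂ := ∫ s in Ioo p c, v s * K₂ s with hN₂
  have hcomb : ∀ x₁ x₂ x₃ x₄ : ℝ,
      IntegrableOn (fun s => v s * K₂ s * x₁ - v s * K₁ s * x₂ - w s * K₂ s * x₃
        + w s * K₁ s * x₄) (Ioo p c) ∧
      ∫ s in Ioo p c, (v s * K₂ s * x₁ - v s * K₁ s * x₂ - w s * K₂ s * x₃
        + w s * K₁ s * x₄) = N₂ * x₁ - N₁ * x₂ - D₂ * x₃ + D₁ * x₄ := by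
    intro x₁ x₂ x₃ x₄
    have i₁ := hv₂.mul_const x₁
    have i₂ := hv₁.mul_const x₂
    have i₃ := hw₂.mul_const x₃
    have i₄ := hw₁.mul_const x₄
    have j₂ : IntegrableOn (fun s => v s * K₂ s * x₁ - v s * K₁ s * x₂) (Ioo p c) := i₁.sub i₂
    have j₃ : IntegrableOn (fun s => v s * K₂ s * x₁ - v s * K₁ s * x₂ - w s * K₂ s * x₃)
      (Ioo p c) := j₂.sub i₃
    refine ⟨j₃.add i₄, ?_⟩
    rw [integral_add j₃ i₄, integral_sub j₂ i₃, integral_sub i₁ i₂]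
    simp only [integral_mul_const, hN₁, hN₂, hD₁, hD₂]
  have hfac : ∀ s t, v s * K₂ s * (w t * K₁ t) - v s * K₁ s * (w t * K₂ t)
        - w s * K₂ s * (v t * K₁ t) + w s * K₁ s * (v t * K₂ t)
      = (v s * w t - w s * v t) * (K₂ s * K₁ t - K₁ s * K₂ t) := by
    intro s t; ring
  have hle : ∀ s ∈ Ioo p c, ∀ t ∈ Ioo p c,
      (v s * w t - w s * v t) * (K₂ s * K₁ t - K₁ s * K₂ t) ≤ 0 := by
    intro s hs t ht
    rcases lt_trichotomy s t with h | h | h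
    · have h1 := hvw s t hs.1 h ht.2
      have h2 := hK s t hs.1 h ht.2
      exact mul_nonpos_of_nonneg_of_nonpos (by linarith) (by linarith)
    · subst h
      simp [mul_comm]
    · have h1 := hvw t s ht.1 h hs.2
      have h2 := hK t s ht.1 h hs.2
      exact mul_nonpos_of_nonpos_of_nonneg (by linarith) (by linarith)
  have hlt : ∀ s ∈ Ioo p b, ∀ t ∈ Ioo p b, s ≠ t →
      (v s * w t - w s * v t) * (K₂ s * K₁ t - K₁ s * K₂ t) < 0 := by
    intro s hs t ht hst
    rcases lt_or_gt_of_ne hst with h | h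
    · have h1 := hvw s t hs.1 h (ht.2.trans_le hbc)
      have h2 := hK' s t hs.1 h (ht.2.trans_le hbc) hs.2
      exact mul_neg_of_pos_of_neg (by linarith) (by linarith)
    · have h1 := hvw t s ht.1 h (hs.2.trans_le hbc)
      have h2 := hK' t s ht.1 h (hs.2.trans_le hbc) ht.2
      exact mul_neg_of_neg_of_pos (by linarith) (by linarith)
  have hIle : ∀ t ∈ Ioo p c, N₂ * (w t * K₁ t) - N₁ * (w t * K₂ t)
      - D₂ * (v t * K₁ t) + D₁ * (v t * K₂ t) ≤ 0 := by
    intro t ht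
    rw [← (hcomb (w t * K₁ t) (w t * K₂ t) (v t * K₁ t) (v t * K₂ t)).2]
    refine setIntegral_nonpos measurableSet_Ioo fun s hs => ?_
    rw [hfac]
    exact hle s hs t ht
  have hIlt : ∀ t ∈ Ioo p b, N₂ * (w t * K₁ t) - N₁ * (w t * K₂ t)
      - D₂ * (v t * K₁ t) + D₁ * (v t * K₂ t) < 0 := by
    intro t ht
    have hc := hcomb (w t * K₁ t) (w t * K₂ t) (v t * K₁ t) (v t * K₂ t)
    rw [← hc.2]
    refine setIntegral_Ioo_neg (t := t) hpb hbc hc.1 (fun s hs => ?_) (fun s hs hst => ?_)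
    · rw [hfac]
      exact hle s hs t ⟨ht.1, ht.2.trans_le hbc⟩
    · rw [hfac]
      exact hlt s hs t ht hst
  have hc := hcomb D₁ D₂ N₁ N₂
  have hfin : ∫ s in Ioo p c, (v s * K₂ s * D₁ - v s * K₁ s * D₂ - w s * K₂ s * N₁
        + w s * K₁ s * N₂) < 0 := by
    refine setIntegral_Ioo_neg (t := p) hpb hbc hc.1 (fun s hs => ?_) (fun s hs _ => ?_)
    · linarith [hIle s hs]
    · linarith [hIlt s hs]
  rw [hc.2] at hfin
  linarith

/-- The functions `h ↦ √(2 (h - s))` form a totally positive kernel. -/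
lemma sqrt_mul_sqrt_le {h₁ h₂ s t : ℝ} (h : h₁ < h₂) (hst : s < t) (ht : t < h₂) :
    √(2 * (h₂ - s)) * √(2 * (h₁ - t)) ≤ √(2 * (h₁ - s)) * √(2 * (h₂ - t)) := by
  rcases le_or_gt h₁ t with h1 | h1
  · rw [Real.sqrt_eq_zero_of_nonpos (by linarith : 2 * (h₁ - t) ≤ 0), mul_zero]
    positivity
  · rw [← Real.sqrt_mul (by linarith), ← Real.sqrt_mul (by linarith)]
    apply Real.sqrt_le_sqrt
    nlinarith [mul_pos (sub_pos.mpr h) (sub_pos.mpr hst)]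

lemma sqrt_mul_sqrt_lt {h₁ h₂ s t : ℝ} (h : h₁ < h₂) (hst : s < t) (ht : t < h₂)
    (hs : s < h₁) :
    √(2 * (h₂ - s)) * √(2 * (h₁ - t)) < √(2 * (h₁ - s)) * √(2 * (h₂ - t)) := by
  rcases le_or_gt h₁ t with h1 | h1
  · rw [Real.sqrt_eq_zero_of_nonpos (by linarith : 2 * (h₁ - t) ≤ 0), mul_zero]
    exact mul_pos (Real.sqrt_pos.mpr (by linarith)) (Real.sqrt_pos.mpr (by linarith))
  · rw [← Real.sqrt_mul (by linarith), ← Real.sqrt_mul (by linarith)]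
    apply Real.sqrt_lt_sqrt
    · exact mul_nonneg (by linarith) (by linarith)
    · nlinarith [mul_pos (sub_pos.mpr h) (sub_pos.mpr hst)]

/-- The monotonicity of the quotient of branch densities: `x < x' < a < y' < y` are the
points of two level sets, the outer pair `(x, y)` belonging to the higher level. -/
lemma branch_density_cross_mul {n : ℕ} {a x x' y y' : ℝ} (hn : n ≠ 0)
    (han : a ^ n = (n : ℝ) + 1) (hx : 0 < x) (hxx : x < x') (hxa : x' < a) (hay : a < y')
    (hyy : y' < y) :
    (y' ^ 0 / |y' * (y' ^ n / ((n : ℝ) + 1) - 1)| + x' ^ 0 / |x' * (x' ^ n / ((n : ℝ) + 1) - 1)|)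
        * (y ^ n / |y * (y ^ n / ((n : ℝ) + 1) - 1)| + x ^ n / |x * (x ^ n / ((n : ℝ) + 1) - 1)|) <
      (y' ^ n / |y' * (y' ^ n / ((n : ℝ) + 1) - 1)| + x' ^ n / |x' * (x' ^ n / ((n : ℝ) + 1) - 1)|)
        * (y ^ 0 / |y * (y ^ n / ((n : ℝ) + 1) - 1)| +
          x ^ 0 / |x * (x ^ n / ((n : ℝ) + 1) - 1)|) := by
  have hN : (0 : ℝ) < (n : ℝ) + 1 := by positivity
  have hx' : 0 < x' := hx.trans hxx
  have hy' : 0 < y' := by linarith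
  have hy : 0 < y := by linarith
  have e1 : x ^ n < x' ^ n := pow_lt_pow_left₀ hxx hx.le hn
  have e2 : x' ^ n < (n : ℝ) + 1 := han ▸ pow_lt_pow_left₀ hxa hx'.le hn
  have e3 : (n : ℝ) + 1 < y' ^ n := han ▸ pow_lt_pow_left₀ hay (by linarith) hn
  have e4 : y' ^ n < y ^ n := pow_lt_pow_left₀ hyy hy'.le hn
  obtain ⟨q, hq⟩ : ∃ q, q = 1 - x ^ n / ((n : ℝ) + 1) := ⟨_, rfl⟩
  obtain ⟨q', hq'⟩ : ∃ q, q = 1 - x' ^ n / ((n : ℝ) + 1) := ⟨_, rfl⟩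
  obtain ⟨r, hr⟩ : ∃ q, q = y ^ n / ((n : ℝ) + 1) - 1 := ⟨_, rfl⟩
  obtain ⟨r', hr'⟩ : ∃ q, q = y' ^ n / ((n : ℝ) + 1) - 1 := ⟨_, rfl⟩
  have xq : x ^ n = ((n : ℝ) + 1) * (1 - q) := by rw [hq]; field_simp; ring
  have xq' : x' ^ n = ((n : ℝ) + 1) * (1 - q') := by rw [hq']; field_simp; ring
  have yr : y ^ n = ((n : ℝ) + 1) * (1 + r) := by rw [hr]; field_simp; ring
  have yr' : y' ^ n = ((n : ℝ) + 1) * (1 + r') := by rw [hr']; field_simp; ring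
  rw [xq, xq'] at e1
  rw [xq'] at e2
  rw [yr'] at e3
  rw [yr, yr'] at e4
  have hqq : q' < q := by nlinarith
  have hq'0 : 0 < q' := by nlinarith
  have hr'0 : 0 < r' := by nlinarith
  have hrr : r' < r := by nlinarith
  have hr0 : 0 < r := by linarith
  have hq0 : 0 < q := by linarith
  have a1 : |x * (x ^ n / ((n : ℝ) + 1) - 1)| = x * q := by
    rw [show x * (x ^ n / ((n : ℝ) + 1) - 1) = -(x * q) by rw [hq]; ring, abs_neg]
    exact abs_of_pos (by positivity)
  have a2 : |x' * (x' ^ n / ((n : ℝ) + 1) - 1)| = x' * q' := by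
    rw [show x' * (x' ^ n / ((n : ℝ) + 1) - 1) = -(x' * q') by rw [hq']; ring, abs_neg]
    exact abs_of_pos (by positivity)
  have a3 : |y * (y ^ n / ((n : ℝ) + 1) - 1)| = y * r := by
    rw [← hr]; exact abs_of_pos (by positivity)
  have a4 : |y' * (y' ^ n / ((n : ℝ) + 1) - 1)| = y' * r' := by
    rw [← hr']; exact abs_of_pos (by positivity)
  rw [a1, a2, a3, a4, xq, xq', yr, yr']
  simp only [pow_zero]
  have hd : 0 < y - x := by linarith
  have hd' : 0 < y' - x' := by linarith
  have f1 : y / (y - x) < y' / (y' - x') := by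
    rw [div_lt_div_iff₀ hd hd']; nlinarith
  have f2 : x / (y - x) < x' / (y' - x') := by
    rw [div_lt_div_iff₀ hd hd']; nlinarith
  have f3 : y / (y - x) / q + x / (y - x) / r < y' / (y' - x') / q' + x' / (y' - x') / r' := by
    gcongr
  have hpos : 0 < ((n : ℝ) + 1) * ((y - x) / (x * y)) * ((y' - x') / (x' * y')) := by positivity
  have h0 := mul_pos hpos (sub_pos.mpr f3)
  refine sub_pos.mp (h0.trans_eq ?_)
  field_simp
  ring

lemma hasDerivAt_potential (n : ℕ) (u : ℝ) :
    HasDerivAt (fun u : ℝ => -u ^ 2 / 2 + u ^ (n + 2) / (((n : ℝ) + 1) * ((n : ℝ) + 2)))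
      (u * (u ^ n / ((n : ℝ) + 1) - 1)) u := by
  have h := ((hasDerivAt_pow 2 u).neg.div_const 2).add
    ((hasDerivAt_pow (n + 2) u).div_const (((n : ℝ) + 1) * ((n : ℝ) + 2)))
  refine h.congr_deriv ?_
  have : (n : ℝ) + 1 ≠ 0 := by positivity
  have : (n : ℝ) + 2 ≠ 0 := by positivity
  push_cast
  field_simp
  ring

theorem stmt_12 (n : ℕ) (hn : 1 ≤ n) (Φ : ℝ → ℝ)
    (hΦ : ∀ u : ℝ, Φ u = -u ^ 2 / 2 + u ^ (n + 2) / (((n : ℝ) + 1) * ((n : ℝ) + 2)))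
    (a B p₁ : ℝ) (ha : a = ((n : ℝ) + 1) ^ ((1 : ℝ) / n))
    (hB : B = (((n : ℝ) + 1) * ((n : ℝ) + 2) / 2) ^ ((1 : ℝ) / n))
    (hp₁ : p₁ = -(n : ℝ) * ((n : ℝ) + 1) ^ ((2 : ℝ) / n) / (2 * ((n : ℝ) + 2)))
    (α β : ℝ → ℝ)
    (hα : ∀ h ∈ Set.Ioo p₁ (0 : ℝ), α h ∈ Set.Ioo (0 : ℝ) a ∧ Φ (α h) = h)
    (hβ : ∀ h ∈ Set.Ioo p₁ (0 : ℝ), β h ∈ Set.Ioo a B ∧ Φ (β h) = h)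
    (A : ℕ → ℝ → ℝ)
    (hA : ∀ (m : ℕ) (h : ℝ),
      A m h = 2 * ∫ u in (α h)..(β h), u ^ m * Real.sqrt (2 * (h - Φ u))) :
    StrictAntiOn (fun h => A n h / A 0 h) (Set.Ioo p₁ 0) := by
  have hn0 : n ≠ 0 := by omega
  have hnR : (n : ℝ) ≠ 0 := by exact_mod_cast hn0
  have hN : (0 : ℝ) < (n : ℝ) + 1 := by positivity
  have ha0 : 0 < a := by rw [ha]; positivity
  have han : a ^ n = (n : ℝ) + 1 := by
    rw [ha, ← Real.rpow_natCast, ← Real.rpow_mul hN.le, one_div_mul_cancel hnR, Real.rpow_one]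
  have ha2 : ((n : ℝ) + 1) ^ ((2 : ℝ) / n) = a ^ 2 := by
    rw [ha, ← Real.rpow_natCast, ← Real.rpow_mul hN.le]
    congr 1
    push_cast
    ring
  have hΦa : Φ a = p₁ := by
    rw [hΦ, hp₁, ha2, pow_add, han]
    field_simp
    ring
  set φ : ℝ → ℝ := fun u => u * (u ^ n / ((n : ℝ) + 1) - 1) with hφ
  have hd : ∀ u, HasDerivAt Φ (φ u) u := by
    intro u
    rw [funext hΦ]
    exact hasDerivAt_potential n u
  have hcont : Continuous Φ := continuous_iff_continuousAt.mpr fun u => (hd u).continuousAt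
  have hφpos : ∀ u, a < u → 0 < φ u := by
    intro u hu
    have h1 : (n : ℝ) + 1 < u ^ n := han ▸ pow_lt_pow_left₀ hu ha0.le hn0
    exact mul_pos (ha0.trans hu) (sub_pos.mpr ((one_lt_div hN).mpr h1))
  have hφneg : ∀ u, 0 < u → u < a → φ u < 0 := by
    intro u hu hua
    have h1 : u ^ n < (n : ℝ) + 1 := han ▸ pow_lt_pow_left₀ hua hu.le hn0
    exact mul_neg_of_pos_of_neg hu (sub_neg.mpr ((div_lt_one hN).mpr h1))
  have hmono : StrictMonoOn Φ (Ici a) := by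
    refine strictMonoOn_of_deriv_pos (convex_Ici a) hcont.continuousOn fun u hu => ?_
    rw [interior_Ici] at hu
    rw [(hd u).deriv]
    exact hφpos u hu
  have hanti : StrictAntiOn Φ (Icc 0 a) := by
    refine strictAntiOn_of_deriv_neg (convex_Icc 0 a) hcont.continuousOn fun u hu => ?_
    rw [interior_Icc] at hu
    rw [(hd u).deriv]
    exact hφneg u hu.1 hu.2
  have hβIci : ∀ h ∈ Ioo p₁ 0, β h ∈ Ici a := fun h hh => (hβ h hh).1.1.le
  have hαIcc : ∀ h ∈ Ioo p₁ 0, α h ∈ Icc 0 a := fun h hh => Ioo_subset_Icc_self (hα h hh).1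
  have hβlt : ∀ s ∈ Ioo p₁ 0, ∀ t ∈ Ioo p₁ 0, s < t → β s < β t := by
    intro s hs t ht hst
    rwa [← hmono.lt_iff_lt (hβIci s hs) (hβIci t ht), (hβ s hs).2, (hβ t ht).2]
  have hαlt : ∀ s ∈ Ioo p₁ 0, ∀ t ∈ Ioo p₁ 0, s < t → α t < α s := by
    intro s hs t ht hst
    rwa [← hanti.lt_iff_gt (hαIcc s hs) (hαIcc t ht), (hα s hs).2, (hα t ht).2]
  have hf : ∀ (m : ℕ) (h : ℝ), Continuous fun u => u ^ m * √(2 * (h - Φ u)) := by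
    intro m h; fun_prop
  intro h₁ hh₁ h₂ hh₂ h12
  have himgβ : Φ '' Ioo a (β h₂) = Ioo p₁ h₂ := by
    ext s
    constructor
    · rintro ⟨u, hu, rfl⟩
      rw [← hΦa]
      exact ⟨hmono (by simp) hu.1.le hu.1, (hmono hu.1.le (hβIci h₂ hh₂) hu.2).trans_eq (hβ h₂ hh₂).2⟩
    · intro hs
      have hs' : s ∈ Ioo p₁ 0 := ⟨hs.1, hs.2.trans hh₂.2⟩
      exact ⟨β s, ⟨(hβ s hs').1.1, hβlt s hs' h₂ hh₂ hs.2⟩, (hβ s hs').2⟩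
  have himgα : Φ '' Ioo (α h₂) a = Ioo p₁ h₂ := by
    have hα2 := hα h₂ hh₂
    ext s
    constructor
    · rintro ⟨u, hu, rfl⟩
      have hu' : u ∈ Icc 0 a := ⟨(hα2.1.1.trans hu.1).le, hu.2.le⟩
      rw [← hΦa]
      exact ⟨hanti hu' ⟨ha0.le, le_rfl⟩ hu.2, (hanti (hαIcc h₂ hh₂) hu' hu.1).trans_eq hα2.2⟩
    · intro hs
      have hs' : s ∈ Ioo p₁ 0 := ⟨hs.1, hs.2.trans hh₂.2⟩
      exact ⟨α s, ⟨hαlt s hs' h₂ hh₂ hs.2, (hα s hs').1.2⟩, (hα s hs').2⟩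
  have hlevel : ∀ s ∈ Ioo p₁ h₂, s ∈ Ioo p₁ 0 := fun s hs => ⟨hs.1, hs.2.trans hh₂.2⟩
  have hinvβ : ∀ u ∈ Ioo a (β h₂), β (Φ u) = u := by
    intro u hu
    have hs := hlevel _ (himgβ ▸ mem_image_of_mem Φ hu)
    exact hmono.injOn (hβIci _ hs) hu.1.le (hβ _ hs).2
  have hinvα : ∀ u ∈ Ioo (α h₂) a, α (Φ u) = u := by
    intro u hu
    have hs := hlevel _ (himgα ▸ mem_image_of_mem Φ hu)
    exact hanti.injOn (hαIcc _ hs) ⟨((hα h₂ hh₂).1.1.trans hu.1).le, hu.2.le⟩ (hα _ hs).2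
  have hright := fun m h => integrableOn_and_setIntegral_comp_branch
    (f := fun u => u ^ m) (K := fun s => √(2 * (h - s))) measurableSet_Ioo
    (fun u _ => hd u) (fun u (hu : u ∈ Ioo a (β h₂)) => (hφpos u hu.1).ne') himgβ hinvβ
    ((hf m h).integrableOn_Icc.mono_set Ioo_subset_Icc_self)
  have hleft := fun m h => integrableOn_and_setIntegral_comp_branch
    (f := fun u => u ^ m) (K := fun s => √(2 * (h - s))) measurableSet_Ioo
    (fun u _ => hd u)
    (fun u (hu : u ∈ Ioo (α h₂) a) => (hφneg u ((hα h₂ hh₂).1.1.trans hu.1) hu.2).ne)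
    himgα hinvα ((hf m h).integrableOn_Icc.mono_set Ioo_subset_Icc_self)
  set w : ℕ → ℝ → ℝ := fun m s => (β s) ^ m / |φ (β s)| + (α s) ^ m / |φ (α s)| with hw
  have hwint : ∀ m h, IntegrableOn (fun s => w m s * √(2 * (h - s))) (Ioo p₁ h₂) := by
    intro m h
    simp only [hw, add_mul]
    exact (hright m h).1.add (hleft m h).1
  have hAeq : ∀ m, ∀ h ∈ Ioo p₁ 0, h ≤ h₂ →
      A m h = 2 * ∫ s in Ioo p₁ h₂, w m s * √(2 * (h - s)) := by
    intro m h hh hle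
    have hαle : α h₂ ≤ α h := by
      rcases hle.eq_or_lt with e | e
      · rw [e]
      · exact (hαlt h hh h₂ hh₂ e).le
    have hβle : β h ≤ β h₂ := by
      rcases hle.eq_or_lt with e | e
      · rw [e]
      · exact (hβlt h hh h₂ hh₂ e).le
    have hii : ∀ x y, IntervalIntegrable (fun u => u ^ m * √(2 * (h - Φ u))) volume x y :=
      fun x y => (hf m h).intervalIntegrable x y
    have z1 : ∫ u in (α h₂)..(α h), u ^ m * √(2 * (h - Φ u)) = 0 := by
      rw [← intervalIntegral.integral_zero (a := α h₂) (b := α h) (μ := volume) (E := ℝ)]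
      refine intervalIntegral.integral_congr fun u hu => ?_
      rw [uIcc_of_le hαle] at hu
      have : h ≤ Φ u := by
        have h3 := hanti.antitoneOn (a := u) (b := α h)
          ⟨(hα h₂ hh₂).1.1.le.trans hu.1, hu.2.trans (hα h hh).1.2.le⟩ (hαIcc h hh) hu.2
        rwa [(hα h hh).2] at h3
      simp [Real.sqrt_eq_zero_of_nonpos (by linarith : 2 * (h - Φ u) ≤ 0)]
    have z2 : ∫ u in (β h)..(β h₂), u ^ m * √(2 * (h - Φ u)) = 0 := by
      rw [← intervalIntegral.integral_zero (a := β h) (b := β h₂) (μ := volume) (E := ℝ)]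
      refine intervalIntegral.integral_congr fun u hu => ?_
      rw [uIcc_of_le hβle] at hu
      have : h ≤ Φ u := by
        have h3 := hmono.monotoneOn (hβIci h hh) (b := u) ((hβIci h hh).trans hu.1) hu.1
        rwa [(hβ h hh).2] at h3
      simp [Real.sqrt_eq_zero_of_nonpos (by linarith : 2 * (h - Φ u) ≤ 0)]
    have s1 := intervalIntegral.integral_add_adjacent_intervals
      (hii (α h₂) (α h)) (hii (α h) (β h))
    have s2 := intervalIntegral.integral_add_adjacent_intervals
      (hii (α h₂) (β h)) (hii (β h) (β h₂))
    have s3 := intervalIntegral.integral_add_adjacent_intervals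
      (hii (α h₂) a) (hii a (β h₂))
    rw [intervalIntegral.integral_of_le (hαIcc h₂ hh₂).2,
      intervalIntegral.integral_of_le (a := a) (hβIci h₂ hh₂), integral_Ioc_eq_integral_Ioo,
      integral_Ioc_eq_integral_Ioo, (hleft m h).2, (hright m h).2, add_comm,
      ← integral_add (hright m h).1 (hleft m h).1] at s3
    simp only [hw, add_mul]
    rw [hA, s3]
    linarith
  have hApos : ∀ h ∈ Ioo p₁ 0, 0 < A 0 h := by
    intro h hh
    rw [hA]
    have hαβ : α h < β h := (hα h hh).1.2.trans (hβ h hh).1.1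
    refine mul_pos two_pos (intervalIntegral.intervalIntegral_pos_of_pos_on
      ((hf 0 h).intervalIntegrable _ _) (fun u hu => ?_) hαβ)
    have hlt : Φ u < h := by
      rcases le_total u a with hua | hua
      · have h3 := hanti (hαIcc h hh) ⟨(hα h hh).1.1.le.trans hu.1.le, hua⟩ hu.1
        rwa [(hα h hh).2] at h3
      · have h3 := hmono hua (hβIci h hh) hu.2
        rwa [(hβ h hh).2] at h3
    have : 0 < 2 * (h - Φ u) := by linarith
    simpa using this
  have key := integral_mul_integral_lt_of_cross_mul (v := w n) (w := w 0)
    (K₁ := fun s => √(2 * (h₁ - s))) (K₂ := fun s => √(2 * (h₂ - s))) hh₁.1 h12.le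
    (hwint 0 h₁) (hwint 0 h₂) (hwint n h₁) (hwint n h₂)
    (fun s t hs hst ht => by
      have hs' : s ∈ Ioo p₁ 0 := ⟨hs, (hst.trans ht).trans hh₂.2⟩
      have ht' : t ∈ Ioo p₁ 0 := ⟨hs.trans hst, ht.trans hh₂.2⟩
      exact branch_density_cross_mul hn0 han (hα t ht').1.1 (hαlt s hs' t ht' hst)
        (hα s hs').1.2 (hβ s hs').1.1 (hβlt s hs' t ht' hst))
    (fun s t _ hst ht => sqrt_mul_sqrt_le h12 hst ht)
    (fun s t _ hst ht hs => sqrt_mul_sqrt_lt h12 hst ht hs)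
  change A n h₂ / A 0 h₂ < A n h₁ / A 0 h₁
  rw [div_lt_div_iff₀ (hApos h₂ hh₂) (hApos h₁ hh₁), hAeq n h₁ hh₁ h12.le,
    hAeq 0 h₁ hh₁ h12.le, hAeq n h₂ hh₂ le_rfl, hAeq 0 h₂ hh₂ le_rfl]
  linarith
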